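/- Let ℙ be a probability measure on Ω₊ under which (ω(x))_{x≥0} is stationary and ergodic. Then either every site x ≥ 0 is ℙ-almost surely ω-recurrent, or every site x ≥ 0 is ℙ-almost surely ω-transient. -/

import Mathlib

open MeasureTheory Filter Set Topology ProbabilityTheory
open scoped ENNReal ENat

noncomputable section

/-- A cookie environment: `ω z i` is the strength of the `(i+1)`-st cookie at site `z`
(cookies at each site are indexed by `i = 0, 1, 2, …`). -/
abbrev CEnv : Type := ℤ → ℕ → ℝ

/-- `ω` belongs to `Ω₊`, i.e. all cookie strengths lie in `[1/2, 1]`. -/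
def IsCookieEnv (ω : CEnv) : Prop := ∀ z i, ω z i ∈ Set.Icc (1/2 : ℝ) 1

/-- The number of visits of the path `x` to the site `x n` at times `m < n`. -/
def prevVisits (x : ℕ → ℤ) (n : ℕ) : ℕ :=
  ((Finset.range n).filter fun m => x m = x n).card

/-- The probability of the step from `x n` to `x (n+1)` for the multi-excited random
walk: jump to the right with the strength of the bottom remaining cookie at the current
site, to the left with the complementary probability. -/
def stepProb (ω : CEnv) (x : ℕ → ℤ) (n : ℕ) : ℝ :=
  if x (n+1) = x n + 1 then ω (x n) (prevVisits x n)
  else if x (n+1) = x n - 1 then 1 - ω (x n) (prevVisits x n)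
  else 0

/-- The probability that the walk started at `x0` follows the path `x` up to time `n`. -/
def cylProb (ω : CEnv) (x0 : ℤ) (x : ℕ → ℤ) (n : ℕ) : ℝ :=
  (if x 0 = x0 then 1 else 0) * ∏ m ∈ Finset.range n, stepProb ω x m

/-- `P` is the law `P_{x0,ω}` of the multi-excited random walk in the cookie
environment `ω` started at `x0`, characterized by its cylinder probabilities. -/
def IsERWLaw (ω : CEnv) (x0 : ℤ) (P : Measure (ℕ → ℤ)) : Prop :=
  IsProbabilityMeasure P ∧
    ∀ (x : ℕ → ℤ) (n : ℕ),
      P {Y | ∀ m ≤ n, Y m = x m} = ENNReal.ofReal (cylProb ω x0 x n)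

/-- First passage time `T_k`, with value `∞` if `k` is never visited. -/
def T (k : ℤ) (Y : ℕ → ℤ) : ℕ∞ :=
  sInf {t : ℕ∞ | ∃ n : ℕ, (n : ℕ∞) = t ∧ Y n = k}

/-- First passage time of an extended-real level, with the convention
`T_{−∞} = T_{+∞} = ∞`. -/
def Te (k : EReal) (Y : ℕ → ℤ) : ℕ∞ :=
  sInf {t : ℕ∞ | ∃ n : ℕ, (n : ℕ∞) = t ∧ ((Y n : ℝ) : EReal) = k}

/-- `R_k`, the event that the site `k` is visited infinitely often. -/
def Rset (k : ℤ) : Set (ℕ → ℤ) := {Y | ∀ N : ℕ, ∃ n ≥ N, Y n = k}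

/-- The number of visits of `Y` to the site `s` at times `< t`. -/
def visitsBefore (Y : ℕ → ℤ) (s : ℤ) (t : ℕ∞) : ℕ∞ :=
  {m : ℕ | (m : ℕ∞) < t ∧ Y m = s}.encard

/-- `D_t^s`: the total drift stored in the cookies consumed at the site `s`
before time `t` (a time in `ℕ∞`; `t = ∞` gives `D_∞^s`). -/
def driftAt (ω : CEnv) (Y : ℕ → ℤ) (s : ℤ) (t : ℕ∞) : ℝ≥0∞ :=
  ∑' i : ℕ, Set.indicator {i : ℕ | (i : ℕ∞) < visitsBefore Y s t}
    (fun i => ENNReal.ofReal (2 * ω s i - 1)) i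

/-- `D_t`: the total drift consumed before time `t` (at all sites). -/
def Dtot (ω : CEnv) (Y : ℕ → ℤ) (t : ℕ∞) : ℝ≥0∞ := ∑' s : ℤ, driftAt ω Y s t

/-- `D_t^+`: the total drift consumed at nonnegative sites before time `t`. -/
def DtotPos (ω : CEnv) (Y : ℕ → ℤ) (t : ℕ∞) : ℝ≥0∞ := ∑' s : ℕ, driftAt ω Y (s : ℤ) t

/-- `δ^s`: the total drift stored in the cookies at the site `s`. -/
def cookieDrift (ω : CEnv) (s : ℤ) : ℝ≥0∞ := ∑' i : ℕ, ENNReal.ofReal (2 * ω s i - 1)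

/-- The successive times `τ_{k,1}, τ_{k,2}, …` (indexed here from `0`) at which the
walk is at a site `≥ k`. -/
def tauT (k : ℤ) (Y : ℕ → ℤ) : ℕ → ℕ∞
  | 0 => sInf {t : ℕ∞ | ∃ n : ℕ, (n : ℕ∞) = t ∧ k ≤ Y n}
  | m + 1 => sInf {t : ℕ∞ | ∃ n : ℕ, (n : ℕ∞) = t ∧ tauT k Y m < (n : ℕ∞) ∧ k ≤ Y n}

/-- The observed sequence `(X_{τ_{k,m}})_{m ≥ 1}` (indexed here from `0`). -/
def obsSeq (k : ℤ) (Y : ℕ → ℤ) (m : ℕ) : ℤ := Y (tauT k Y m).toNat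

/-- The one-sided shift on sequences. -/
def shiftSeq {α : Type*} (u : ℕ → α) : ℕ → α := fun n => u (n + 1)

/-- The restriction `(ω(x))_{x ≥ 0}` of an environment to the nonnegative sites. -/
def restrictNN (ω : CEnv) : ℕ → ℕ → ℝ := fun x => ω (x : ℤ)

/-- `(ω(x))_{x ≥ 0}` is stationary under `Pr`: its law is invariant under the shift. -/
def IsStationaryEnv (Pr : Measure CEnv) : Prop :=
  MeasurePreserving shiftSeq (Pr.map restrictNN) (Pr.map restrictNN)

/-- `(ω(x))_{x ≥ 0}` is stationary and ergodic under `Pr`. -/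
def IsStatErgEnv (Pr : Measure CEnv) : Prop :=
  Ergodic shiftSeq (Pr.map restrictNN)

/-- The process `ξ_k = ((ω(x+k))_{x≥0}, (X_{τ_{k,m}} − k)_{m≥0})` consisting of the
environment to the right of `k` and the trajectory at sites `≥ k`, recentered at `k`. -/
def xiProc (p : CEnv × (ℕ → ℤ)) (k : ℕ) : (ℕ → ℕ → ℝ) × (ℕ → ℤ) :=
  (fun x : ℕ => p.1 ((x : ℤ) + (k : ℤ)), fun m => obsSeq (k : ℤ) p.2 m - (k : ℤ))

/-- The walk started at `x` driven by the stacks of arrows `a` (`true` means a step to the right):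
its state at time `n` is the current position together with the numbers of previous visits. -/
def stackWalk (x : ℤ) (a : ℤ × ℕ → Bool) : ℕ → ℤ × (ℤ → ℕ)
  | 0 => (x, 0)
  | n + 1 =>
    let s := stackWalk x a n
    (s.1 + (if a (s.1, s.2 s.1) then 1 else -1), Function.update s.2 s.1 (s.2 s.1 + 1))

/-- The position at time `n` of the walk driven by `a`. -/
def pos (x : ℤ) (a : ℤ × ℕ → Bool) (n : ℕ) : ℤ := (stackWalk x a n).1

/-- The number of visits to `z` before time `n` of the walk driven by `a`. -/
def visits (x : ℤ) (a : ℤ × ℕ → Bool) (n : ℕ) (z : ℤ) : ℕ := (stackWalk x a n).2 z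

section Deterministic

variable {x : ℤ} {a : ℤ × ℕ → Bool}

@[simp] lemma pos_zero : pos x a 0 = x := rfl

@[simp] lemma visits_zero (z : ℤ) : visits x a 0 z = 0 := rfl

lemma pos_succ (n : ℕ) :
    pos x a (n + 1) = pos x a n + if a (pos x a n, visits x a n (pos x a n)) then 1 else -1 := rfl

lemma visits_succ (n : ℕ) (z : ℤ) :
    visits x a (n + 1) z = visits x a n z + if pos x a n = z then 1 else 0 := by
  have h : visits x a (n + 1) z =
    Function.update (stackWalk x a n).2 (pos x a n) ((stackWalk x a n).2 (pos x a n) + 1) z := rfl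
  rw [h, Function.update_apply]
  by_cases hz : pos x a n = z
  · subst hz
    simp [visits]
  · simp [visits, hz, Ne.symm hz]

lemma visits_mono (z : ℤ) : Monotone fun n => visits x a n z :=
  monotone_nat_of_le_succ fun n => by simp [visits_succ]

lemma visits_le (n : ℕ) (z : ℤ) : visits x a n z ≤ n := by
  induction n with
  | zero => simp
  | succ n ih => rw [visits_succ]; split_ifs <;> omega

lemma visits_eq_card (n : ℕ) (z : ℤ) :
    visits x a n z = ((Finset.range n).filter fun m => pos x a m = z).card := by
  induction n with
  | zero => simp
  | succ n ih =>
    rw [visits_succ, Finset.range_add_one, Finset.filter_insert, ih]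
    split_ifs <;> simp

lemma prevVisits_pos (n : ℕ) : prevVisits (pos x a) n = visits x a n (pos x a n) := by
  rw [visits_eq_card, prevVisits]

lemma pos_succ_le (n : ℕ) : pos x a (n + 1) ≤ pos x a n + 1 := by
  rw [pos_succ]; split_ifs <;> omega

lemma pos_succ_ge (n : ℕ) : pos x a n - 1 ≤ pos x a (n + 1) := by
  rw [pos_succ]; split_ifs <;> omega

/-- Net flow through the edge from `z` to `z + 1`: right arrows used at `z` minus left arrows
used at `z + 1`. -/
lemma flow (z : ℤ) (n : ℕ) :
    (Nat.count (fun i => a (z, i) = true) (visits x a n z) : ℤ)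
      - Nat.count (fun i => a (z + 1, i) = false) (visits x a n (z + 1))
      = (if x ≤ z then 1 else 0) - if pos x a n ≤ z then 1 else 0 := by
  induction n with
  | zero =>
    change (0 : ℤ) - 0 = (if x ≤ z then 1 else 0) - if x ≤ z then 1 else 0
    rw [sub_self, sub_self]
  | succ n ih =>
    rw [visits_succ, visits_succ, pos_succ]
    by_cases h1 : pos x a n = z
    · have h2 : pos x a n ≠ z + 1 := by omega
      simp only [h1] at ih ⊢
      cases h : a (z, visits x a n z) <;> simp [h, Nat.count_succ] at ih ⊢ <;> omega
    · by_cases h2 : pos x a n = z + 1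
      · simp only [h2] at ih ⊢
        cases h : a (z + 1, visits x a n (z + 1)) <;> simp [h, Nat.count_succ] at ih ⊢ <;> omega
      · simp only [h1, h2, if_false, add_zero, ih]
        congr 1
        split_ifs <;> omega

/-- Walks started at or below `k`, using the same arrows at the sites `≥ k` (up to translation
by `d`): if the second one is not bounded above, then it visits each of these sites at least
as often as the first one. -/
lemma exists_visits_le {x' : ℤ} {a' : ℤ × ℕ → Bool} {k d : ℤ} (hx : x ≤ k) (hx' : x' ≤ k + d)
    (haa : ∀ z, k ≤ z → ∀ i, a' (z + d, i) = a (z, i))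
    (hsup : ∀ (K : ℤ) (N : ℕ), ∃ n ≥ N, K < pos x' a' n) (n : ℕ) :
    ∀ z, k ≤ z → ∃ t, visits x a n z ≤ visits x' a' t (z + d) := by
  induction n with
  | zero => intro z _; exact ⟨0, by simp⟩
  | succ n ih =>
    intro z hz
    rw [visits_succ]
    split_ifs with hp
    swap
    · exact ih z hz
    by_contra! hcon
    obtain ⟨t₀, h₀⟩ := ih z hz
    obtain ⟨t₁, h₁⟩ := ih (z + 1) (by omega)
    obtain ⟨t, ht, htz⟩ := hsup (z + d) (max t₀ t₁)
    have e₀ : visits x' a' t (z + d) = visits x a n z := by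
      have := visits_mono (x := x') (a := a') (z + d) ((le_max_left _ _).trans ht)
      have := hcon t
      dsimp only at *
      omega
    have e₁ : visits x a n (z + 1) ≤ visits x' a' t (z + d + 1) := by
      have := visits_mono (x := x') (a := a') (z + 1 + d) ((le_max_right _ _).trans ht)
      rw [add_right_comm]
      exact h₁.trans this
    have f := flow (x := x) (a := a) z n
    have f' := flow (x := x') (a := a') (z + d) t
    have hm := Nat.count_monotone (fun i => a (z + 1, i) = false) e₁
    rw [e₀] at f'
    have s₀ : (fun i => a' (z + d, i) = true) = fun i => a (z, i) = true := by
      funext i; rw [haa z hz]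
    have s₁ : (fun i => a' (z + d + 1, i) = false) = fun i => a (z + 1, i) = false := by
      funext i; rw [add_right_comm, haa (z + 1) (by omega)]
    simp only [s₀, s₁] at f'
    rw [if_pos (by omega), if_pos (by omega)] at f
    rw [if_pos (by omega), if_neg (by omega)] at f'
    omega

lemma pos_mem_Rset_iff (k : ℤ) : pos x a ∈ Rset k ↔ ∀ m, ∃ t, m ≤ visits x a t k := by
  constructor
  · intro h m
    induction m with
    | zero => exact ⟨0, by simp⟩
    | succ m ih =>
      obtain ⟨t, ht⟩ := ih
      obtain ⟨n, hn, hk⟩ := h t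
      refine ⟨n + 1, ?_⟩
      have := visits_mono (x := x) (a := a) k hn
      dsimp only at this
      rw [visits_succ, if_pos hk]
      omega
  · intro h N
    by_contra! hcon
    obtain ⟨t, ht⟩ := h (visits x a N k + 1)
    have key : ∀ s, visits x a (N + s) k = visits x a N k := by
      intro s
      induction s with
      | zero => rfl
      | succ s ih => rw [← add_assoc, visits_succ, if_neg (hcon _ (by omega)), ih, add_zero]
    have := visits_mono (x := x) (a := a) k (Nat.le_add_left t N)
    have := key t
    dsimp only at *
    omega

lemma mem_Rset_of_mem_Rset {x' : ℤ} {a' : ℤ × ℕ → Bool} {k d : ℤ} (hx : x ≤ k)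
    (hx' : x' ≤ k + d) (haa : ∀ z, k ≤ z → ∀ i, a' (z + d, i) = a (z, i))
    (hsup : ∀ (K : ℤ) (N : ℕ), ∃ n ≥ N, K < pos x' a' n) (h : pos x a ∈ Rset k) :
    pos x' a' ∈ Rset (k + d) := by
  rw [pos_mem_Rset_iff] at h ⊢
  intro m
  obtain ⟨t, ht⟩ := h m
  obtain ⟨s, hs⟩ := exists_visits_le hx hx' haa hsup t k le_rfl
  exact ⟨s, ht.trans hs⟩

lemma exists_pos_eq {n m : ℕ} (hnm : n ≤ m) {z : ℤ} (hn : pos x a n ≤ z) (hm : z ≤ pos x a m) :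
    ∃ t ≥ n, pos x a t = z := by
  induction m, hnm using Nat.le_induction with
  | base => exact ⟨n, le_rfl, by omega⟩
  | succ m hnm ih =>
    by_cases h : z ≤ pos x a m
    · exact ih h
    · exact ⟨m + 1, by omega, by have := pos_succ_le (x := x) (a := a) m; omega⟩

lemma Rset_succ (hsup : ∀ (K : ℤ) (N : ℕ), ∃ n ≥ N, K < pos x a n) {k : ℤ}
    (h : pos x a ∈ Rset k) : pos x a ∈ Rset (k + 1) := by
  intro N
  obtain ⟨n, hn, hk⟩ := h N
  obtain ⟨m, hm, hK⟩ := hsup k n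
  obtain ⟨t, ht, h'⟩ := exists_pos_eq (x := x) (a := a) (z := k + 1) hm (by omega) (by omega)
  exact ⟨t, by omega, h'⟩

lemma Rset_mono (hsup : ∀ (K : ℤ) (N : ℕ), ∃ n ≥ N, K < pos x a n) {k l : ℤ} (hkl : k ≤ l)
    (h : pos x a ∈ Rset k) : pos x a ∈ Rset l := by
  induction l, hkl using Int.leInduction with
  | base => exact h
  | succ l _ ih => exact Rset_succ hsup ih

lemma exists_left_arrow_of_mem_Rset (hsup : ∀ (K : ℤ) (N : ℕ), ∃ n ≥ N, K < pos x a n) {k : ℤ}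
    (h : pos x a ∈ Rset k) (m : ℕ) : ∃ i ≥ m, a (k + 1, i) = false := by
  by_contra! hcon
  obtain ⟨t, ht⟩ := (pos_mem_Rset_iff (k + 1)).1 (Rset_succ hsup h) m
  obtain ⟨n, hn, hkn⟩ := hsup k t
  have key : ∀ s, n ≤ s → k < pos x a s := by
    intro s hs
    induction s, hs using Nat.le_induction with
    | base => exact hkn
    | succ s hs ih =>
      by_cases hp : pos x a s = k + 1
      · have hv := visits_mono (x := x) (a := a) (k + 1) (hn.trans hs)
        have := hcon (visits x a s (k + 1)) (ht.trans hv)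
        rw [pos_succ, hp, if_pos (by simpa using this)]
        omega
      · have := pos_succ_ge (x := x) (a := a) s
        omega
  obtain ⟨s, hs, hk⟩ := h n
  have := key s hs
  omega

lemma exists_pos_eq_visits_eq {k : ℤ} {i t : ℕ} (h : i < visits x a t k) :
    ∃ s, pos x a s = k ∧ visits x a s k = i := by
  induction t with
  | zero => simp at h
  | succ t ih =>
    by_cases h' : i < visits x a t k
    · exact ih h'
    · rw [visits_succ] at h
      split_ifs at h with hp
      · exact ⟨t, hp, by omega⟩
      · omega

lemma Rset_of_Rset_succ {k : ℤ} (hleft : ∀ m, ∃ i ≥ m, a (k + 1, i) = false)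
    (h : pos x a ∈ Rset (k + 1)) : pos x a ∈ Rset k := by
  intro N
  obtain ⟨i, hi, hai⟩ := hleft N
  obtain ⟨t, ht⟩ := (pos_mem_Rset_iff (k + 1)).1 h (i + 1)
  obtain ⟨s, hs, hsi⟩ := exists_pos_eq_visits_eq (Nat.lt_of_succ_le ht)
  have := visits_le (x := x) (a := a) s (k + 1)
  exact ⟨s + 1, by omega, by rw [pos_succ, hs, hsi, hai]; simp⟩

lemma Rset_of_Rset {k l : ℤ} (hkl : k ≤ l)
    (hleft : ∀ z, k < z → ∀ m, ∃ i ≥ m, a (z, i) = false) (h : pos x a ∈ Rset l) :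
    pos x a ∈ Rset k := by
  induction l, hkl using Int.leInduction with
  | base => exact h
  | succ l hl ih => exact ih (Rset_of_Rset_succ (hleft _ (by omega)) h)

end Deterministic

/-- The law of an arrow with probability `ω p.1 p.2` (truncated to `[0, 1]`) of pointing right. -/
def arrowBernoulli (ω : CEnv) (p : ℤ × ℕ) : Measure Bool :=
  ENNReal.ofReal (max 0 (min (ω p.1 p.2) 1)) • Measure.dirac true +
    ENNReal.ofReal (1 - max 0 (min (ω p.1 p.2) 1)) • Measure.dirac false

instance (ω : CEnv) (p : ℤ × ℕ) : IsProbabilityMeasure (arrowBernoulli ω p) := by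
  constructor
  simp only [arrowBernoulli, Measure.coe_add, Measure.coe_smul, Pi.add_apply, Pi.smul_apply,
    measure_univ, smul_eq_mul, mul_one]
  rw [← ENNReal.ofReal_add (by positivity) (by simp), add_sub_cancel, ENNReal.ofReal_one]

/-- The law of the stacks of arrows: independent arrows with laws given by the cookies. -/
def arrowLaw (ω : CEnv) : Measure (ℤ × ℕ → Bool) := Measure.infinitePi (arrowBernoulli ω)

instance (ω : CEnv) : IsProbabilityMeasure (arrowLaw ω) := by
  unfold arrowLaw; infer_instance

lemma IsCookieEnv.arrowBernoulli_eq {ω : CEnv} (hω : IsCookieEnv ω) (p : ℤ × ℕ) :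
    arrowBernoulli ω p = ENNReal.ofReal (ω p.1 p.2) • Measure.dirac true +
      ENNReal.ofReal (1 - ω p.1 p.2) • Measure.dirac false := by
  have h := hω p.1 p.2
  rw [arrowBernoulli, min_eq_left h.2, max_eq_right (by linarith [h.1])]

lemma measurable_stackWalk (x : ℤ) (n : ℕ) : Measurable fun a => stackWalk x a n := by
  induction n with
  | zero => exact measurable_const
  | succ n ih =>
    have h1 : Measurable fun a => (stackWalk x a n).1 := measurable_fst.comp ih
    have h2 : Measurable fun a => (stackWalk x a n).2 := measurable_snd.comp ih
    have h3 : Measurable fun a => (stackWalk x a n).2 (stackWalk x a n).1 := by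
      have : Measurable fun q : (ℤ → ℕ) × ℤ => q.1 q.2 :=
        measurable_from_prod_countable_left fun z => measurable_pi_apply z
      exact this.comp (h2.prodMk h1)
    have h4 : Measurable fun a : ℤ × ℕ → Bool =>
        a ((stackWalk x a n).1, (stackWalk x a n).2 (stackWalk x a n).1) := by
      have : Measurable fun q : (ℤ × ℕ → Bool) × (ℤ × ℕ) => q.1 q.2 :=
        measurable_from_prod_countable_left fun z => measurable_pi_apply z
      exact this.comp (measurable_id.prodMk (h1.prodMk h3))
    refine Measurable.prodMk (h1.add (Measurable.ite (h4 (measurableSet_singleton true))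
      measurable_const measurable_const)) (measurable_pi_iff.2 fun z => ?_)
    simp only [Function.update_apply]
    exact Measurable.ite (measurableSet_eq_fun measurable_const h1) (h3.add_const 1)
      ((measurable_pi_apply z).comp h2)

lemma measurable_pos (x : ℤ) : Measurable (pos x) :=
  measurable_pi_iff.2 fun n => measurable_fst.comp (measurable_stackWalk x n)

lemma measurableSet_Rset (k : ℤ) : MeasurableSet (Rset k) := by
  have : Rset k = ⋂ N : ℕ, ⋃ n : ℕ, ⋃ _ : n ≥ N, {Y : ℕ → ℤ | Y n = k} := by
    ext Y; simp [Rset]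
  rw [this]
  exact .iInter fun N => .iUnion fun n => .iUnion fun _ =>
    measurableSet_eq_fun (measurable_pi_apply n) measurable_const

lemma prevVisits_congr {y y' : ℕ → ℤ} {n : ℕ} (h : ∀ m ≤ n, y m = y' m) :
    prevVisits y n = prevVisits y' n := by
  unfold prevVisits
  congr 1
  refine Finset.filter_congr fun m hm => ?_
  rw [h n le_rfl, h m (Finset.mem_range.1 hm).le]

lemma injective_prevVisits (y : ℕ → ℤ) : Function.Injective fun m => (y m, prevVisits y m) := by
  have key : ∀ m n, m < n → y m = y n → prevVisits y m < prevVisits y n := by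
    intro m n hmn h
    unfold prevVisits
    refine Finset.card_lt_card ⟨fun i hi => ?_, fun hsub => ?_⟩
    · simp only [Finset.mem_filter, Finset.mem_range] at hi ⊢
      exact ⟨hi.1.trans hmn, hi.2.trans h⟩
    · have := @hsub m (by simp [hmn, h])
      simp at this
  intro m n h
  simp only [Prod.mk.injEq] at h
  rcases lt_trichotomy m n with hlt | heq | hgt
  · exact absurd h.2 (key m n hlt h.1).ne
  · exact heq
  · exact absurd h.2 (key n m hgt h.1.symm).ne'

lemma pos_eq_iff {x : ℤ} {a : ℤ × ℕ → Bool} {y : ℕ → ℤ} (hy : y 0 = x) (n : ℕ) :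
    (∀ m ≤ n, pos x a m = y m) ↔
      ∀ m < n, y (m + 1) = y m + if a (y m, prevVisits y m) then 1 else -1 := by
  constructor
  · intro h m hm
    have hp : prevVisits y m = visits x a m (y m) := by
      rw [← prevVisits_congr fun i hi => h i (hi.trans hm.le), prevVisits_pos, h m hm.le]
    rw [← h (m + 1) hm, pos_succ, h m hm.le, hp]
  · intro h m
    induction m using Nat.strong_induction_on with
    | _ m ih =>
      intro hm
      cases m with
      | zero => simp [hy]
      | succ m =>
        have hlt : ∀ i ≤ m, pos x a i = y i := fun i hi => ih i (by omega) (by omega)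
        have hp : prevVisits y m = visits x a m (y m) := by
          rw [← prevVisits_congr hlt, prevVisits_pos, hlt m le_rfl]
        rw [h m hm, pos_succ, hlt m le_rfl, hp]

lemma IsCookieEnv.arrowBernoulli_step {ω : CEnv} (hω : IsCookieEnv ω) (y : ℕ → ℤ) (m : ℕ) :
    arrowBernoulli ω (y m, prevVisits y m) {b | y (m + 1) = y m + if b then 1 else -1} =
      ENNReal.ofReal (stepProb ω y m) := by
  rw [hω.arrowBernoulli_eq]
  simp only [Measure.coe_add, Measure.coe_smul, Pi.add_apply, Pi.smul_apply, smul_eq_mul,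
    Measure.dirac_apply, Set.indicator_apply, Set.mem_ofPred_eq, stepProb]
  by_cases h1 : y (m + 1) = y m + 1
  · have : ¬ y m + 1 = y m + -1 := by omega
    simp [h1, this]
  · by_cases h2 : y (m + 1) = y m - 1
    · have : ¬ y m - 1 = y m + 1 := by omega
      simp [h2, this, ← sub_eq_add_neg]
    · have : ¬ y (m + 1) = y m + -1 := by omega
      simp [h1, h2, this]

lemma IsCookieEnv.stepProb_nonneg {ω : CEnv} (hω : IsCookieEnv ω) (y : ℕ → ℤ) (m : ℕ) :
    0 ≤ stepProb ω y m := by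
  have h := hω (y m) (prevVisits y m)
  unfold stepProb
  split_ifs <;> linarith [h.1, h.2]

lemma arrowLaw_cylinder {ω : CEnv} (hω : IsCookieEnv ω) (x : ℤ) (y : ℕ → ℤ) (n : ℕ) :
    arrowLaw ω {a | ∀ m ≤ n, pos x a m = y m} = ENNReal.ofReal (cylProb ω x y n) := by
  by_cases hy : y 0 = x
  swap
  · have : {a | ∀ m ≤ n, pos x a m = y m} = ∅ :=
      Set.eq_empty_of_forall_notMem fun a ha => hy (ha 0 (Nat.zero_le n)).symm
    simp [this, cylProb, hy]
  have hset : {a | ∀ m ≤ n, pos x a m = y m} =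
      Set.pi ((Finset.range n).image fun m => (y m, prevVisits y m) : Finset (ℤ × ℕ))
        (fun p => {b | ∀ m < n, (y m, prevVisits y m) = p →
          y (m + 1) = y m + if b then 1 else -1}) := by
    ext a
    simp only [Set.mem_ofPred_eq, pos_eq_iff hy, Set.mem_pi, Finset.coe_image, Set.mem_image,
      Finset.coe_range, Set.mem_Iio]
    constructor
    · rintro h _ - m hm rfl
      exact h m hm
    · intro h m hm
      exact h _ ⟨m, hm, rfl⟩ m hm rfl
  rw [hset, arrowLaw, Measure.infinitePi_pi _ fun _ _ => MeasurableSet.of_discrete,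
    Finset.prod_image (injective_prevVisits y).injOn, cylProb, if_pos hy, one_mul,
    ENNReal.ofReal_prod_of_nonneg fun m _ => hω.stepProb_nonneg y m]
  refine Finset.prod_congr rfl fun m hm => ?_
  rw [← hω.arrowBernoulli_step]
  congr 1
  ext b
  constructor
  · intro h
    exact h m (Finset.mem_range.1 hm) rfl
  · intro h m' _ heq
    rw [injective_prevVisits y heq]
    exact h

lemma measurableSet_cylinder (y : ℕ → ℤ) (n : ℕ) :
    MeasurableSet {Y : ℕ → ℤ | ∀ m ≤ n, Y m = y m} := by
  have : {Y : ℕ → ℤ | ∀ m ≤ n, Y m = y m} = ⋂ m : ℕ, ⋂ _ : m ≤ n, {Y | Y m = y m} := by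
    ext; simp
  rw [this]
  exact .iInter fun m => .iInter fun _ =>
    measurableSet_eq_fun (measurable_pi_apply m) measurable_const

lemma isERWLaw_map_pos {ω : CEnv} (hω : IsCookieEnv ω) (x : ℤ) :
    IsERWLaw ω x ((arrowLaw ω).map (pos x)) :=
  ⟨Measure.isProbabilityMeasure_map (measurable_pos x).aemeasurable, fun y n => by
    rw [Measure.map_apply (measurable_pos x) (measurableSet_cylinder y n),
      ← arrowLaw_cylinder hω]
    rfl⟩

lemma frestrictLe_preimage_singleton (n : ℕ) (d : Finset.Iic n → ℤ) :
    Preorder.frestrictLe (π := fun _ : ℕ => ℤ) n ⁻¹' {d} =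
      {Y | ∀ m ≤ n, Y m = if h : m ≤ n then d ⟨m, Finset.mem_Iic.2 h⟩ else d ⟨n, by simp⟩ + 1} := by
  ext Y
  simp only [Set.mem_preimage, Set.mem_singleton_iff, funext_iff, Subtype.forall, Finset.mem_Iic,
    Set.mem_ofPred_eq, Preorder.frestrictLe_apply]
  exact forall₂_congr fun m hm => by rw [dif_pos hm]

lemma IsERWLaw.unique {ω : CEnv} {x : ℤ} {P P' : Measure (ℕ → ℤ)} (h : IsERWLaw ω x P)
    (h' : IsERWLaw ω x P') : P = P' := by
  have := h.1
  have := h'.1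
  refine (IsProjectiveLimit.unique (P := fun I => P'.map I.restrict) (fun I => ?_) fun I => rfl)
  revert I
  refine (isProjectiveLimit_nat_iff (isProjectiveMeasureFamily_map_restrict
    fun t => (measurable_pi_apply t).aemeasurable) P).2 fun n => ?_
  refine Measure.ext_of_singleton fun d => ?_
  have hm := Preorder.measurable_frestrictLe (X := fun _ : ℕ => ℤ) n
  rw [Measure.map_apply hm (measurableSet_singleton d), frestrictLe_preimage_singleton, h.2,
    ← h'.2, ← frestrictLe_preimage_singleton]
  exact (Measure.map_apply hm (measurableSet_singleton d)).symm

lemma abs_pos_succ_sub (x : ℤ) (a : ℤ × ℕ → Bool) (n : ℕ) :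
    |(pos x a (n + 1) : ℝ) - pos x a n| = 1 := by
  rw [pos_succ]
  split_ifs <;> simp

lemma abs_pos_le (x : ℤ) (a : ℤ × ℕ → Bool) (n : ℕ) : |(pos x a n : ℝ)| ≤ |(x : ℝ)| + n := by
  induction n with
  | zero => simp
  | succ n ih =>
    have h := abs_pos_succ_sub x a n
    have := abs_add_le ((pos x a (n + 1) : ℝ) - pos x a n) (pos x a n)
    rw [sub_add_cancel] at this
    push_cast
    linarith

lemma measurable_pos_cast (x : ℤ) (n : ℕ) :
    Measurable fun a : ℤ × ℕ → Bool => (pos x a n : ℝ) :=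
  measurable_from_top.comp ((measurable_pi_apply n).comp (measurable_pos x))

lemma integrable_pos (ω : CEnv) (x : ℤ) (n : ℕ) :
    Integrable (fun a => (pos x a n : ℝ)) (arrowLaw ω) :=
  .of_bound (measurable_pos_cast x n).aestronglyMeasurable _
    (Eventually.of_forall fun a => abs_pos_le x a n)

/-- The filtration generated by the walk. -/
def walkFiltration (x : ℤ) :
    Filtration ℕ (inferInstance : MeasurableSpace (ℤ × ℕ → Bool)) where
  seq n := MeasurableSpace.comap
    (fun a => Preorder.frestrictLe (π := fun _ : ℕ => ℤ) n (pos x a)) inferInstance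
  mono' m n hmn := by
    rintro _ ⟨s, hs, rfl⟩
    exact ⟨Preorder.frestrictLe₂ (π := fun _ : ℕ => ℤ) hmn ⁻¹' s,
      Preorder.measurable_frestrictLe₂ hmn hs, rfl⟩
  le' n := ((Preorder.measurable_frestrictLe n).comp (measurable_pos x)).comap_le

lemma cylProb_succ (ω : CEnv) (x : ℤ) (y : ℕ → ℤ) (n : ℕ) :
    cylProb ω x y (n + 1) = cylProb ω x y n * stepProb ω y n := by
  rw [cylProb, cylProb, Finset.prod_range_succ, mul_assoc]

lemma IsCookieEnv.cylProb_nonneg {ω : CEnv} (hω : IsCookieEnv ω) (x : ℤ) (y : ℕ → ℤ) (n : ℕ) :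
    0 ≤ cylProb ω x y n :=
  mul_nonneg (by split_ifs <;> norm_num) (Finset.prod_nonneg fun m _ => hω.stepProb_nonneg y m)

lemma setIntegral_cylinder_nonneg {ω : CEnv} (hω : IsCookieEnv ω) (x : ℤ) (n : ℕ)
    (d : Finset.Iic n → ℤ) :
    0 ≤ ∫ a in pos x ⁻¹' (Preorder.frestrictLe (π := fun _ : ℕ => ℤ) n ⁻¹' {d}),
      ((pos x a (n + 1) : ℝ) - pos x a n) ∂arrowLaw ω := by
  rw [frestrictLe_preimage_singleton]
  set y : ℕ → ℤ := fun m => if h : m ≤ n then d ⟨m, Finset.mem_Iic.2 h⟩ else d ⟨n, by simp⟩ + 1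
    with hy
  have hyn : y (n + 1) = y n + 1 := by simp [hy]
  set C : Set (ℤ × ℕ → Bool) := pos x ⁻¹' {Y | ∀ m ≤ n, Y m = y m} with hC
  set U : Set (ℤ × ℕ → Bool) := {a | pos x a (n + 1) = pos x a n + 1} with hU
  have hCm : MeasurableSet C := measurable_pos x (measurableSet_cylinder y n)
  have hUm : MeasurableSet U :=
    measurableSet_eq_fun ((measurable_pi_apply (n + 1)).comp (measurable_pos x))
      (((measurable_pi_apply n).comp (measurable_pos x)).add_const 1)
  have hint : (fun a => (pos x a (n + 1) : ℝ) - pos x a n) =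
      fun a => 2 * U.indicator (fun _ => (1 : ℝ)) a - 1 := by
    funext a
    by_cases ha : a ∈ U
    · have h1 : pos x a (n + 1) = pos x a n + 1 := ha
      simp only [Set.indicator_of_mem ha, h1]
      push_cast
      ring
    · have h1 : pos x a (n + 1) ≠ pos x a n + 1 := ha
      rw [Set.indicator_of_notMem ha]
      rw [pos_succ] at h1 ⊢
      split_ifs with h
      · simp [h] at h1
      · push_cast
        ring
  have hUC : U ∩ C = {a | ∀ m ≤ n + 1, pos x a m = y m} := by
    ext a
    constructor
    · rintro ⟨h1, h2⟩ m hm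
      rcases hm.lt_or_eq with h | rfl
      · exact h2 m (by omega)
      · have h3 : pos x a n = y n := h2 n le_rfl
        rw [hyn, ← h3]
        exact h1
    · intro h
      refine ⟨?_, fun m hm => h m (by omega)⟩
      have h1 := h (n + 1) le_rfl
      rw [hyn, ← h n (by omega)] at h1
      exact h1
  have hpC : (arrowLaw ω).real C = cylProb ω x y n := by
    rw [measureReal_def, hC, Set.preimage_ofPred_eq, arrowLaw_cylinder hω,
      ENNReal.toReal_ofReal (hω.cylProb_nonneg x y n)]
  have hpU : (arrowLaw ω).real (U ∩ C) = cylProb ω x y n * ω (y n) (prevVisits y n) := by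
    rw [measureReal_def, hUC, arrowLaw_cylinder hω,
      ENNReal.toReal_ofReal (hω.cylProb_nonneg x y _), cylProb_succ, stepProb, if_pos hyn]
  rw [hint, integral_sub, integral_const_mul, integral_indicator hUm, setIntegral_const,
    setIntegral_const, measureReal_restrict_apply hUm, hpC, hpU]
  · have h1 := hω.cylProb_nonneg x y n
    have h2 := (hω (y n) (prevVisits y n)).1
    simp only [smul_eq_mul, mul_one]
    nlinarith
  · exact ((integrable_const (1 : ℝ)).indicator hUm).const_mul 2
  · exact integrable_const _

lemma submartingale_pos {ω : CEnv} (hω : IsCookieEnv ω) (x : ℤ) :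
    Submartingale (fun n a => (pos x a n : ℝ)) (walkFiltration x) (arrowLaw ω) := by
  refine submartingale_of_setIntegral_le_succ (fun n => ?_) (integrable_pos ω x) ?_
  · refine Measurable.stronglyMeasurable ?_
    have h1 : Measurable fun d : Finset.Iic n → ℤ => (d ⟨n, by simp⟩ : ℝ) :=
      measurable_from_top.comp (measurable_pi_apply _)
    exact h1.comp (comap_measurable _)
  · rintro n _ ⟨D, hD, rfl⟩
    rw [← sub_nonneg, ← integral_sub (integrable_pos ω x _).integrableOn
      (integrable_pos ω x _).integrableOn]
    have hset : (fun a => Preorder.frestrictLe (π := fun _ : ℕ => ℤ) n (pos x a)) ⁻¹' D =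
        ⋃ d : D, pos x ⁻¹' (Preorder.frestrictLe (π := fun _ : ℕ => ℤ) n ⁻¹' {d.1}) := by
      ext a
      simp
    rw [hset, integral_iUnion]
    · exact tsum_nonneg fun d => setIntegral_cylinder_nonneg hω x n d.1
    · exact fun d => measurable_pos x
        (Preorder.measurable_frestrictLe n (measurableSet_singleton _))
    · intro d d' hdd
      refine Set.disjoint_left.2 fun a h h' => hdd (Subtype.ext ?_)
      simp only [Set.mem_preimage, Set.mem_singleton_iff] at h h'
      exact h.symm.trans h'
    · exact ((integrable_pos ω x _).sub (integrable_pos ω x _)).integrableOn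

lemma ae_unbounded {ω : CEnv} (hω : IsCookieEnv ω) (x : ℤ) :
    ∀ᵐ a ∂arrowLaw ω, ∀ (K : ℤ) (N : ℕ), ∃ n ≥ N, K < pos x a n := by
  have h := (submartingale_pos hω x).bddAbove_iff_exists_tendsto (R := 1)
    (Eventually.of_forall fun a n => by simpa using (abs_pos_succ_sub x a n).le)
  filter_upwards [h] with a ha K N
  by_contra! hcon
  obtain ⟨c, hc⟩ := ha.1 ⟨max K (|x| + N), by
    rintro _ ⟨n, rfl⟩
    dsimp only
    rcases le_total N n with hn | hn
    · exact le_max_of_le_left (by exact_mod_cast hcon n hn)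
    · refine le_max_of_le_right (((le_abs_self _).trans (abs_pos_le x a n)).trans ?_)
      push_cast
      gcongr⟩
  have h1 := ((hc.comp (tendsto_add_atTop_nat 1)).sub hc).abs
  simp only [Function.comp_apply, abs_pos_succ_sub, sub_self, abs_zero] at h1
  exact one_ne_zero (tendsto_nhds_unique tendsto_const_nhds h1)

lemma measurable_arrowLaw : Measurable arrowLaw := by
  refine Measurable.measure_of_isPiSystem_of_isProbabilityMeasure
    generateFrom_squareCylinders.symm
    (isPiSystem_squareCylinders (fun _ => MeasurableSpace.isPiSystem_measurableSet) (by simp)) ?_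
  rintro _ ⟨s, t, -, rfl⟩
  have : (fun ω => arrowLaw ω ((s : Set (ℤ × ℕ)).pi t)) =
      fun ω => ∏ p ∈ s, arrowBernoulli ω p (t p) := by
    funext ω
    rw [arrowLaw, Measure.infinitePi_pi _ fun _ _ => MeasurableSet.of_discrete]
  rw [this]
  refine Finset.measurable_fun_prod s fun p _ => ?_
  have h1 : Measurable fun ω : CEnv => max 0 (min (ω p.1 p.2) 1) := by fun_prop
  simp only [arrowBernoulli, Measure.coe_add, Measure.coe_smul, Pi.add_apply, Pi.smul_apply,
    smul_eq_mul]
  exact (h1.ennreal_ofReal.mul_const _).add ((measurable_const.sub h1).ennreal_ofReal.mul_const _)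

/-- Translate the arrows at the sites `≥ k` to the sites `≥ 0`, and put right arrows at all the
negative sites. -/
def shiftArrows (k : ℤ) (a : ℤ × ℕ → Bool) : ℤ × ℕ → Bool :=
  fun p => if 0 ≤ p.1 then a (p.1 + k, p.2) else true

/-- The environment with cookies `e` at the sites `≥ 0`, and of strength `1` elsewhere. -/
def extEnv (e : ℕ → ℕ → ℝ) : CEnv := fun z i => if 0 ≤ z then e z.toNat i else 1

lemma isCookieEnv_extEnv {e : ℕ → ℕ → ℝ} (he : ∀ n i, e n i ∈ Set.Icc (1 / 2 : ℝ) 1) :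
    IsCookieEnv (extEnv e) := by
  intro z i
  unfold extEnv
  split_ifs
  · exact he _ _
  · norm_num

lemma measurable_extEnv : Measurable extEnv := by
  refine measurable_pi_iff.2 fun z => measurable_pi_iff.2 fun i => ?_
  unfold extEnv
  split_ifs <;> fun_prop

lemma measurable_shiftArrows (k : ℤ) : Measurable (shiftArrows k) := by
  refine measurable_pi_iff.2 fun p => ?_
  unfold shiftArrows
  split_ifs <;> fun_prop

lemma map_shiftArrows (ω : CEnv) (k : ℕ) :
    (arrowLaw ω).map (shiftArrows k) = arrowLaw (extEnv fun n => ω ((n + k : ℕ) : ℤ)) := by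
  refine Measure.eq_infinitePi _ fun s t ht => ?_
  have hset : shiftArrows k ⁻¹' ((s : Set (ℤ × ℕ)).pi t) =
      Set.pi (s.image fun p => (p.1 + (k : ℤ), p.2) : Finset (ℤ × ℕ)) (fun q =>
        {b | (if 0 ≤ q.1 - (k : ℤ) then b else true) ∈ t (q.1 - k, q.2)}) := by
    ext a
    simp only [Set.mem_preimage, Set.mem_pi, Finset.coe_image, Set.forall_mem_image, shiftArrows,
      Set.mem_ofPred_eq, add_sub_cancel_right]
  have hinj : Function.Injective fun p : ℤ × ℕ => (p.1 + (k : ℤ), p.2) := by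
    rintro ⟨p, i⟩ ⟨q, j⟩ h
    simpa using h
  rw [Measure.map_apply (measurable_shiftArrows k)
    (MeasurableSet.pi s.countable_toSet fun p _ => ht p), hset, arrowLaw,
    Measure.infinitePi_pi _ fun _ _ => MeasurableSet.of_discrete, Finset.prod_image hinj.injOn]
  refine Finset.prod_congr rfl fun p _ => ?_
  simp only [add_sub_cancel_right]
  by_cases hp : 0 ≤ p.1
  · have : arrowBernoulli (extEnv fun n => ω ((n + k : ℕ) : ℤ)) p =
        arrowBernoulli ω (p.1 + k, p.2) := by
      simp [arrowBernoulli, extEnv, hp]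
    rw [this]
    simp [hp]
  · have : arrowBernoulli (extEnv fun n => ω ((n + k : ℕ) : ℤ)) p = Measure.dirac true := by
      simp [arrowBernoulli, extEnv, hp]
    rw [this, Measure.dirac_apply' _ (ht p)]
    simp only [hp, if_false]
    by_cases h : true ∈ t p
    · rw [Set.indicator_of_mem h,
        Set.eq_univ_of_forall (s := {_b | true ∈ t (p.1, p.2)}) fun _ => h, measure_univ, Pi.one_apply]
    · rw [Set.indicator_of_notMem h,
        Set.eq_empty_of_forall_notMem (s := {_b | true ∈ t (p.1, p.2)}) fun _ => h, measure_empty]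

/-- A version of Kolmogorov's zero-one law: an event which, for each `k`, is almost surely equal
to an event not depending on the coordinates in `N k` has probability `0` or `1`. -/
lemma infinitePi_zero_or_one {ι α : Type*} [MeasurableSpace α] (μ : ι → Measure α)
    [∀ i, IsProbabilityMeasure (μ i)] {N : ℕ → Set ι} (hN : Monotone N) (hN' : ⋃ k, N k = univ)
    {R : Set (ι → α)} (hR : MeasurableSet R)
    (h : ∀ k, ∃ B, MeasurableSet[⨆ i ∈ (N k)ᶜ,
        MeasurableSpace.comap (fun f : ι → α => f i) inferInstance] B ∧
      R =ᵐ[Measure.infinitePi μ] B) :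
    Measure.infinitePi μ R = 0 ∨ Measure.infinitePi μ R = 1 := by
  set m : ι → MeasurableSpace (ι → α) := fun i => MeasurableSpace.comap (fun f => f i) inferInstance
  have hm : ∀ i, m i ≤ MeasurableSpace.pi := fun i => (measurable_pi_apply i).comap_le
  have hind : iIndep m (Measure.infinitePi μ) :=
    iIndepFun_infinitePi (P := μ) (X := fun _ b => b) fun _ => measurable_id
  have hle : ∀ k, ⨆ i ∈ N k, m i ≤ MeasurableSpace.pi := fun k => iSup₂_le fun i _ => hm i
  have hRle : MeasurableSpace.generateFrom {R} ≤ MeasurableSpace.pi :=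
    MeasurableSpace.generateFrom_le fun t ht => by rw [Set.mem_singleton_iff.1 ht]; exact hR
  have key : ∀ k, Indep (⨆ i ∈ N k, m i) (MeasurableSpace.generateFrom {R})
      (Measure.infinitePi μ) := by
    intro k
    obtain ⟨B, hB, hRB⟩ := h k
    refine IndepSets.indep (hle k) hRle
      (@MeasurableSpace.isPiSystem_measurableSet _ (⨆ i ∈ N k, m i))
      (IsPiSystem.singleton R) (@MeasurableSpace.generateFrom_measurableSet _ (⨆ i ∈ N k, m i)).symm
      rfl ?_
    rw [IndepSets_iff]
    rintro A t hA ht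
    rw [Set.mem_singleton_iff.1 ht, measure_congr ((ae_eq_refl A).inter hRB), measure_congr hRB]
    exact (Indep_iff _ _ _).1 (indep_biSup_compl hm hind (N k)) A B hA hB
  have hmono : Monotone fun k => ⨆ i ∈ N k, m i :=
    fun k l hkl => biSup_mono fun i hi => hN hkl hi
  have hall := indep_iSup_of_monotone key hle hRle hmono
  have hRm : MeasurableSet[⨆ k, ⨆ i ∈ N k, m i] R := by
    have : MeasurableSpace.pi ≤ ⨆ k, ⨆ i ∈ N k, m i := by
      refine iSup_le fun i => ?_
      obtain ⟨k, hk⟩ := Set.mem_iUnion.1 (hN' ▸ Set.mem_univ i)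
      exact le_iSup_of_le k (le_iSup₂_of_le i hk le_rfl)
    exact this _ hR
  refine measure_eq_zero_or_one_of_indepSet_self ((indepSet_iff_measure_inter_eq_mul hR hR _).2 ?_)
  exact (Indep_iff _ _ _).1 hall R R hRm (MeasurableSpace.measurableSet_generateFrom rfl)

/-- The probability that the walk started at `0` in the environment `extEnv e` visits `0`
infinitely often. -/
def recProb (e : ℕ → ℕ → ℝ) : ℝ≥0∞ := arrowLaw (extEnv e) (pos 0 ⁻¹' Rset 0)

lemma measurable_recProb : Measurable recProb :=
  (Measure.measurable_coe (measurable_pos 0 (measurableSet_Rset 0))).comp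
    (measurable_arrowLaw.comp measurable_extEnv)

lemma Rset_preimage_ae_eq {ω : CEnv} (hω : IsCookieEnv ω) {x : ℤ} {k : ℕ} (hx : x ≤ k) :
    pos x ⁻¹' Rset k =ᵐ[arrowLaw ω] shiftArrows k ⁻¹' (pos 0 ⁻¹' Rset 0) := by
  have h := ae_unbounded (isCookieEnv_extEnv (e := fun n => ω ((n + k : ℕ) : ℤ))
    fun n i => hω _ i) 0
  rw [← map_shiftArrows] at h
  filter_upwards [ae_unbounded hω x, ae_of_ae_map (measurable_shiftArrows k).aemeasurable h]
    with a h1 h2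
  refine propext ⟨fun hR => ?_, fun hR => ?_⟩
  · have := mem_Rset_of_mem_Rset (d := -(k : ℤ)) hx (by simp) (fun z hz i => by
      have : 0 ≤ z + -(k : ℤ) := by omega
      simp [shiftArrows, this]) h2 hR
    rwa [add_neg_cancel] at this
  · have := mem_Rset_of_mem_Rset (x' := x) (a' := a) (d := (k : ℤ)) le_rfl (by simpa using hx)
      (fun z hz i => by simp [shiftArrows, hz]) h1 hR
    rwa [zero_add] at this

lemma arrowLaw_Rset {ω : CEnv} (hω : IsCookieEnv ω) {x : ℤ} {k : ℕ} (hx : x ≤ k) :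
    arrowLaw ω (pos x ⁻¹' Rset k) = recProb fun n => ω ((n + k : ℕ) : ℤ) := by
  rw [measure_congr (Rset_preimage_ae_eq hω hx), recProb, ← map_shiftArrows,
    Measure.map_apply (measurable_shiftArrows k) (measurable_pos 0 (measurableSet_Rset 0))]

lemma recProb_le_shiftSeq {e : ℕ → ℕ → ℝ} (he : ∀ n i, e n i ∈ Set.Icc (1 / 2 : ℝ) 1) :
    recProb e ≤ recProb (shiftSeq e) := by
  have hω := isCookieEnv_extEnv he
  have h : shiftSeq e = fun n => extEnv e ((n + 1 : ℕ) : ℤ) := by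
    funext n i
    have : (0 : ℤ) ≤ (n : ℤ) + 1 := by omega
    simp [shiftSeq, extEnv, this]
  rw [h, ← arrowLaw_Rset hω (x := 0) (by simp), recProb]
  refine measure_mono_ae ?_
  filter_upwards [ae_unbounded hω 0] with a ha hR
  exact Rset_succ ha hR

lemma measurable_restrictNN : Measurable restrictNN :=
  measurable_pi_iff.2 fun n => measurable_pi_apply (n : ℤ)

lemma shiftSeq_iterate {α : Type*} (k : ℕ) (u : ℕ → α) : shiftSeq^[k] u = fun n => u (n + k) := by
  induction k generalizing u with
  | zero => rfl
  | succ k ih =>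
    rw [Function.iterate_succ_apply, ih]
    funext n
    simp [shiftSeq, add_assoc]

/-- Under a stationary and ergodic environment, the recurrence probability of each site is almost
surely equal to the same constant. -/
lemma exists_recProb_eq {Pr : Measure CEnv} [IsProbabilityMeasure Pr]
    (hcookie : ∀ᵐ ω ∂Pr, IsCookieEnv ω) (hstat : IsStatErgEnv Pr) :
    ∃ c, ∀ᵐ ω ∂Pr, ∀ k : ℕ, recProb (fun n => ω ((n + k : ℕ) : ℤ)) = c := by
  have hprob : IsProbabilityMeasure (Pr.map restrictNN) :=
    Measure.isProbabilityMeasure_map measurable_restrictNN.aemeasurable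
  have hle : recProb ≤ᵐ[Pr.map restrictNN] recProb ∘ shiftSeq := by
    have : ∀ᵐ e ∂Pr.map restrictNN, ∀ n i, e n i ∈ Set.Icc (1 / 2 : ℝ) 1 := by
      refine ae_all_iff.2 fun n => ae_all_iff.2 fun i => ?_
      refine (ae_map_iff measurable_restrictNN.aemeasurable
        (p := fun e : ℕ → ℕ → ℝ => e n i ∈ Set.Icc (1 / 2 : ℝ) 1) (measurableSet_Icc.preimage
        ((measurable_pi_apply i).comp (measurable_pi_apply n)))).2 ?_
      filter_upwards [hcookie] with ω hω using hω n i
    filter_upwards [this] with e he using recProb_le_shiftSeq he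
  have hint := hstat.toMeasurePreserving.lintegral_comp measurable_recProb
  have heq := ae_eq_of_ae_le_of_lintegral_le hle
    (ne_top_of_le_ne_top ENNReal.one_ne_top (by
      calc ∫⁻ e, recProb e ∂Pr.map restrictNN ≤ ∫⁻ _, 1 ∂Pr.map restrictNN :=
            lintegral_mono fun e => prob_le_one
        _ = 1 := by simp))
    (measurable_recProb.comp hstat.measurable).aemeasurable hint.le
  obtain ⟨c, hc⟩ := hstat.ae_eq_const_of_ae_eq_comp₀ measurable_recProb.nullMeasurable heq.symm
  refine ⟨c, ae_all_iff.2 fun k => ?_⟩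
  have hk := (hstat.toMeasurePreserving.iterate k).quasiMeasurePreserving.ae hc
  filter_upwards [ae_of_ae_map measurable_restrictNN.aemeasurable hk] with ω hω
  rw [shiftSeq_iterate] at hω
  exact hω

section Fixed

variable {ω : CEnv} {c : ℝ≥0∞}

lemma zero_or_one_of_recProb_eq (hω : IsCookieEnv ω)
    (hc : ∀ k : ℕ, recProb (fun n => ω ((n + k : ℕ) : ℤ)) = c) : c = 0 ∨ c = 1 := by
  have hprob : ∀ k : ℕ, arrowLaw ω (pos 0 ⁻¹' Rset k) = c := fun k =>
    (arrowLaw_Rset hω (by simp)).trans (hc k)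
  have hmeas : ∀ k : ℕ, MeasurableSet (pos 0 ⁻¹' Rset k) := fun k =>
    measurable_pos 0 (measurableSet_Rset k)
  have heq : ∀ k : ℕ, pos 0 ⁻¹' Rset (0 : ℕ) =ᵐ[arrowLaw ω] pos 0 ⁻¹' Rset k := by
    intro k
    refine ae_eq_of_ae_subset_of_measure_ge ?_ ((hprob k).trans (hprob 0).symm).le
      (hmeas 0).nullMeasurableSet (measure_ne_top _ _)
    filter_upwards [ae_unbounded hω 0] with a ha hR
    exact Rset_mono ha (by simp) hR
  rw [← hprob 0]
  refine infinitePi_zero_or_one (arrowBernoulli ω) (N := fun k : ℕ => {p | p.1 < (k : ℤ)})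
    (fun k l hkl p (hp : p.1 < (k : ℤ)) => show p.1 < (l : ℤ) by omega) ?_ (hmeas 0) fun k =>
    ⟨_, ?_, (heq k).trans (Rset_preimage_ae_eq hω (by simp))⟩
  · refine Set.eq_univ_of_forall fun p => Set.mem_iUnion.2 ⟨p.1.toNat + 1, ?_⟩
    simp only [Set.mem_ofPred_eq]
    omega
  · suffices h : Measurable[⨆ i ∈ {p : ℤ × ℕ | p.1 < (k : ℤ)}ᶜ,
        MeasurableSpace.comap (fun f : ℤ × ℕ → Bool => f i) inferInstance] (shiftArrows k) from
      h (measurable_pos 0 (measurableSet_Rset 0))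
    refine @measurable_pi_lambda _ _ _ (_) _ _ fun p => ?_
    by_cases hp : 0 ≤ p.1
    · simp only [shiftArrows, hp, if_true]
      refine Measurable.mono (comap_measurable _) ?_ le_rfl
      exact le_iSup₂_of_le (p.1 + (k : ℤ), p.2) (by simpa using hp) le_rfl
    · simp only [shiftArrows, hp, if_false]
      exact measurable_const

lemma arrowLaw_Rset_eq_of_recProb_eq (hω : IsCookieEnv ω)
    (hc : ∀ k : ℕ, recProb (fun n => ω ((n + k : ℕ) : ℤ)) = c) (x : ℤ) (k : ℕ) :
    arrowLaw ω (pos x ⁻¹' Rset k) = c := by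
  set l : ℕ := max k x.toNat
  have hxl : x ≤ l := by omega
  have hkl : (k : ℤ) ≤ l := by omega
  have hl : arrowLaw ω (pos x ⁻¹' Rset l) = c := (arrowLaw_Rset hω hxl).trans (hc l)
  rcases zero_or_one_of_recProb_eq hω hc with rfl | rfl
  · refine le_antisymm (hl ▸ measure_mono_ae ?_) zero_le
    filter_upwards [ae_unbounded hω x] with a ha hR
    exact Rset_mono ha hkl hR
  · have hk : ∀ᵐ a ∂arrowLaw ω, a ∈ pos k ⁻¹' Rset k := (prob_compl_eq_zero_iff
      (measurable_pos _ (measurableSet_Rset _))).2 ((arrowLaw_Rset hω le_rfl).trans (hc k))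
    refine le_antisymm prob_le_one (hl ▸ measure_mono_ae ?_)
    filter_upwards [hk, ae_unbounded hω k] with a ha hsup hR
    refine Rset_of_Rset hkl (fun z hz m => ?_) hR
    have := exists_left_arrow_of_mem_Rset hsup (Rset_mono hsup (l := z - 1) (by omega) ha) m
    rwa [sub_add_cancel] at this

end Fixed

/-- Theorem 12. If `(ω(x))_{x≥0}` is stationary and ergodic under
`Pr`, then either every site `y ≥ 0` is `Pr`-a.s. `ω`-recurrent, or every site
`y ≥ 0` is `Pr`-a.s. `ω`-transient. -/
theorem erw_recurrence_dichotomy (Pr : Measure CEnv) [IsProbabilityMeasure Pr]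
    (hcookie : ∀ᵐ ω ∂Pr, IsCookieEnv ω)
    (hstat : IsStatErgEnv Pr)
    (P : CEnv → ℤ → Measure (ℕ → ℤ))
    (hP : ∀ ω, IsCookieEnv ω → ∀ x, IsERWLaw ω x (P ω x)) :
    (∀ y : ℤ, 0 ≤ y → ∀ᵐ ω ∂Pr, ∀ x, P ω x (Rset y) = 1) ∨
      (∀ y : ℤ, 0 ≤ y → ∀ᵐ ω ∂Pr, ∀ x, P ω x (Rset y) = 0) := by
  obtain ⟨c, hc⟩ := exists_recProb_eq hcookie hstat
  have key : ∀ y : ℤ, 0 ≤ y → ∀ᵐ ω ∂Pr, ∀ x, P ω x (Rset y) = c := by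
    intro y hy
    lift y to ℕ using hy
    filter_upwards [hcookie, hc] with ω hω hcω x
    rw [(hP ω hω x).unique (isERWLaw_map_pos hω x),
      Measure.map_apply (measurable_pos x) (measurableSet_Rset _)]
    exact arrowLaw_Rset_eq_of_recProb_eq hω hcω x y
  obtain ⟨ω, hω, hcω⟩ := (hcookie.and hc).exists
  rcases zero_or_one_of_recProb_eq hω hcω with rfl | rfl
  · exact Or.inr key
  · exact Or.inl key

end
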